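/- Let n ≥ 2, 1 < p < ∞, 0 < s < min{1, n/p}, and let G ⊂ ℝⁿ be a John domain with dim_𝒜(∂G) < n − sp. Then the zero extension operator E₀ : W^{s,p}(G) → W^{s,p}(ℝⁿ), (E₀f)(x) = f(x) for x ∈ G and 0 otherwise, is bounded: ‖E₀f‖_{W^{s,p}(ℝⁿ)} ≤ C ‖f‖_{W^{s,p}(G)}. -/

import Mathlib

open MeasureTheory Metric Set
open scoped ENNReal

noncomputable section

/-- `G` is a John domain with John constant `β` and John center `x₀`. -/
def IsJohnDomain (n : ℕ) (G : Set (EuclideanSpace ℝ (Fin n))) (β : ℝ)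
    (x₀ : EuclideanSpace ℝ (Fin n)) : Prop :=
  IsOpen G ∧ IsConnected G ∧ Bornology.IsBounded G ∧ x₀ ∈ G ∧ 1 ≤ β ∧
    ∀ x ∈ G, ∃ (L : ℝ) (γ : ℝ → EuclideanSpace ℝ (Fin n)),
      0 ≤ L ∧ L ≤ β * diam G ∧ γ 0 = x ∧ γ L = x₀ ∧
      (∀ t ∈ Icc 0 L, γ t ∈ G) ∧ LipschitzOnWith 1 γ (Icc 0 L) ∧
      ∀ t ∈ Icc 0 L, t / β ≤ infDist (γ t) (frontier G)

/-- The Aikawa dimension of `S` is strictly less than `d`. -/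
def aikawaDimLT (n : ℕ) (S : Set (EuclideanSpace ℝ (Fin n))) (d : ℝ) : Prop :=
  ∃ t C₀ : ℝ, 0 < t ∧ t < d ∧ 0 < C₀ ∧
    ∀ x ∈ S, ∀ r : ℝ, 0 < r →
      ∫⁻ y in ball x r, (ENNReal.ofReal (infDist y S)) ^ (t - (n : ℝ)) ≤
        ENNReal.ofReal (C₀ * r ^ t)

/-- The `p`-th power `L^p` integral of `f` over `A`. -/
def lpInt (n : ℕ) (p : ℝ) (A : Set (EuclideanSpace ℝ (Fin n)))
    (f : EuclideanSpace ℝ (Fin n) → ℝ) : ℝ≥0∞ :=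
  ∫⁻ x in A, ENNReal.ofReal (|f x| ^ p)

/-- The `p`-th power of the Gagliardo seminorm of `f` over `A`. -/
def gagliardo (n : ℕ) (s p : ℝ) (A : Set (EuclideanSpace ℝ (Fin n)))
    (f : EuclideanSpace ℝ (Fin n) → ℝ) : ℝ≥0∞ :=
  ∫⁻ x in A, ∫⁻ y in A, ENNReal.ofReal (|f x - f y| ^ p / ‖x - y‖ ^ ((n : ℝ) + s * p))

/-- The `W^{s,p}(A)` norm of `f`. -/
def sobNorm (n : ℕ) (s p : ℝ) (A : Set (EuclideanSpace ℝ (Fin n)))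
    (f : EuclideanSpace ℝ (Fin n) → ℝ) : ℝ≥0∞ :=
  (lpInt n p A f) ^ (1 / p) + (gagliardo n s p A f) ^ (1 / p)

/-- The ball around a point of an open set reaching up to the frontier stays inside the set. -/
theorem ball_infDist_frontier_subset {E : Type*} [NormedAddCommGroup E] [NormedSpace ℝ E]
    {G : Set E} (hG : IsOpen G) {x : E} (hx : x ∈ G) :
    ball x (infDist x (frontier G)) ⊆ G := by
  intro y hy
  have hr : 0 < infDist x (frontier G) := dist_nonneg.trans_lt hy
  refine (convex_ball x _).isPreconnected.subset_of_closure_inter_subset hG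
    ⟨x, mem_ball_self hr, hx⟩ ?_ hy
  rintro z ⟨hz, hzb⟩
  by_contra hzG
  have hzf : z ∈ frontier G := by
    rw [hG.frontier_eq]
    exact ⟨hz, hzG⟩
  have h := infDist_le_dist_of_mem (x := x) hzf
  rw [mem_ball, dist_comm] at hzb
  exact absurd hzb (not_lt.2 h)

theorem lintegral_comp_inv_smul_sub {n : ℕ} {h : EuclideanSpace ℝ (Fin n) → ℝ≥0∞}
    (hh : Measurable h) (x : EuclideanSpace ℝ (Fin n)) {r : ℝ} (hr : 0 < r) :
    ∫⁻ y, h (r⁻¹ • (x - y)) = ENNReal.ofReal (r ^ (n : ℝ)) * ∫⁻ y, h y := by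
  rw [lintegral_sub_left_eq_self (fun y => h (r⁻¹ • y)) x,
    ← lintegral_map (μ := volume) hh (measurable_const_smul r⁻¹),
    Measure.map_addHaar_smul _ (inv_ne_zero hr.ne'), lintegral_smul_measure]
  simp [abs_of_pos, hr]

/-- The tail integral of `‖x - y‖ ^ (-a)` outside a ball scales like `r ^ (n - a)`. -/
theorem exists_lintegral_compl_ball_le (n : ℕ) {a : ℝ} (ha : (n : ℝ) < a) :
    ∃ C : ℝ≥0∞, C ≠ ⊤ ∧ ∀ (x : EuclideanSpace ℝ (Fin n)) (r : ℝ), 0 < r →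
      ∫⁻ y in (ball x r)ᶜ, ENNReal.ofReal (1 / ‖x - y‖ ^ a) ≤
        C * ENNReal.ofReal (r ^ ((n : ℝ) - a)) := by
  have ha0 : 0 < a := (Nat.cast_nonneg n).trans_lt ha
  have hfin := finite_integral_one_add_norm (E := EuclideanSpace ℝ (Fin n))
    (μ := volume) (r := a) (by simpa using ha)
  refine ⟨ENNReal.ofReal (2 ^ a) * ∫⁻ y : EuclideanSpace ℝ (Fin n),
    ENNReal.ofReal ((1 + ‖y‖) ^ (-a)), ENNReal.mul_ne_top ENNReal.ofReal_ne_top hfin.ne,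
    fun x r hr => ?_⟩
  have hpt : ∀ y ∈ (ball x r)ᶜ, ENNReal.ofReal (1 / ‖x - y‖ ^ a) ≤
      ENNReal.ofReal (2 ^ a * r ^ (-a)) *
        ENNReal.ofReal ((1 + ‖r⁻¹ • (x - y)‖) ^ (-a)) := by
    intro y hy
    have hy' : r ≤ ‖x - y‖ := by
      simpa [dist_eq_norm, norm_sub_rev] using hy
    rw [← ENNReal.ofReal_mul (by positivity)]
    refine ENNReal.ofReal_le_ofReal ?_
    have hpos : 0 < ‖x - y‖ := hr.trans_le hy'
    rw [norm_smul, Real.norm_of_nonneg (by positivity), mul_assoc,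
      ← Real.mul_rpow hr.le (by positivity), Real.rpow_neg (by positivity), ← div_eq_mul_inv,
      ← Real.div_rpow (by positivity) (by positivity), one_div,
      ← Real.inv_rpow (by positivity)]
    refine Real.rpow_le_rpow (by positivity) ?_ ha0.le
    have : r * (1 + r⁻¹ * ‖x - y‖) = r + ‖x - y‖ := by field_simp
    rw [this, inv_eq_one_div, div_le_div_iff₀ hpos (by positivity)]
    linarith
  calc ∫⁻ y in (ball x r)ᶜ, ENNReal.ofReal (1 / ‖x - y‖ ^ a)
      ≤ ∫⁻ y in (ball x r)ᶜ, ENNReal.ofReal (2 ^ a * r ^ (-a)) *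
        ENNReal.ofReal ((1 + ‖r⁻¹ • (x - y)‖) ^ (-a)) :=
        setLIntegral_mono' measurableSet_ball.compl hpt
    _ ≤ ∫⁻ y, ENNReal.ofReal (2 ^ a * r ^ (-a)) *
        ENNReal.ofReal ((1 + ‖r⁻¹ • (x - y)‖) ^ (-a)) := setLIntegral_le_lintegral _ _
    _ = ENNReal.ofReal (2 ^ a * r ^ (-a)) * (ENNReal.ofReal (r ^ (n : ℝ)) *
        ∫⁻ y : EuclideanSpace ℝ (Fin n), ENNReal.ofReal ((1 + ‖y‖) ^ (-a))) := by
        rw [lintegral_const_mul' _ _ ENNReal.ofReal_ne_top,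
          lintegral_comp_inv_smul_sub
            (h := fun z => ENNReal.ofReal ((1 + ‖z‖) ^ (-a))) (by fun_prop) x hr]
    _ = _ := by
        rw [sub_eq_add_neg, Real.rpow_add hr, ENNReal.ofReal_mul (by positivity),
          ENNReal.ofReal_mul (by positivity)]
        ring

/-- The points of `G` at distance comparable to `Λ * dist (x, ∂G)` from `x` whose own distance to
the frontier is at least of that order. -/
def whitneyRegion {E : Type*} [PseudoMetricSpace E] (G : Set E) (β Λ : ℝ) (x : E) : Set E :=
  {y | y ∈ G ∧ dist x y ≤ 2 * Λ * infDist x (frontier G) ∧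
    Λ * infDist x (frontier G) ≤ 2 * β * infDist y (frontier G)}

theorem measurableSet_whitneyRegion_uncurry {n : ℕ} {G : Set (EuclideanSpace ℝ (Fin n))}
    (hG : IsOpen G) (β Λ : ℝ) :
    MeasurableSet {q : EuclideanSpace ℝ (Fin n) × EuclideanSpace ℝ (Fin n) |
      q.2 ∈ whitneyRegion G β Λ q.1} := by
  have hd : Continuous fun x : EuclideanSpace ℝ (Fin n) => infDist x (frontier G) :=
    continuous_infDist_pt _
  simp only [whitneyRegion, ofPred_and]
  refine (measurable_snd hG.measurableSet).inter
    ((measurableSet_le ?_ ?_).inter (measurableSet_le ?_ ?_))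
  · fun_prop
  · exact ((hd.comp continuous_fst).const_mul _ |>.measurable)
  · exact ((hd.comp continuous_fst).const_mul _ |>.measurable)
  · exact ((hd.comp continuous_snd).const_mul _ |>.measurable)

theorem measurableSet_whitneyRegion {n : ℕ} {G : Set (EuclideanSpace ℝ (Fin n))}
    (hG : IsOpen G) (β Λ : ℝ) (x : EuclideanSpace ℝ (Fin n)) :
    MeasurableSet (whitneyRegion G β Λ x) :=
  (measurable_prodMk_left (x := x)) (measurableSet_whitneyRegion_uncurry hG β Λ)

/-- Near the frontier of a John domain, one can move away from the frontier to any fixed multiple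
of the distance to it. -/
theorem IsJohnDomain.exists_ball_subset_whitneyRegion {n : ℕ}
    {G : Set (EuclideanSpace ℝ (Fin n))} {β : ℝ} {x₀ : EuclideanSpace ℝ (Fin n)}
    (h : IsJohnDomain n G β x₀) {Λ : ℝ} (hΛ : 1 ≤ Λ) {x : EuclideanSpace ℝ (Fin n)} (hx : x ∈ G)
    (hd : infDist x (frontier G) < infDist x₀ (frontier G) / (1 + Λ)) :
    ∃ z, ball z (Λ * infDist x (frontier G) / (2 * β)) ⊆ whitneyRegion G β Λ x := by
  obtain ⟨hG, -, -, -, hβ, hγ⟩ := h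
  obtain ⟨L, γ, hL, -, h0, hL₀, hmem, hlip, hdist⟩ := hγ x hx
  set d := infDist x (frontier G)
  have hd0 : 0 ≤ d := infDist_nonneg
  have hβ0 : 0 < β := by linarith
  have hxx₀ : dist x x₀ ≤ L := by
    have := hlip.dist_le_mul 0 ⟨le_rfl, hL⟩ L ⟨hL, le_rfl⟩
    rw [h0, hL₀] at this
    simpa [abs_of_nonneg hL] using this
  have hΛd : Λ * d ∈ Icc 0 L := by
    refine ⟨by positivity, ?_⟩
    have h1 : infDist x₀ (frontier G) ≤ d + dist x₀ x := infDist_le_infDist_add_dist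
    rw [lt_div_iff₀ (by positivity)] at hd
    rw [dist_comm] at h1
    nlinarith
  have hz : dist x (γ (Λ * d)) ≤ Λ * d := by
    have := hlip.dist_le_mul 0 ⟨le_rfl, hL⟩ (Λ * d) hΛd
    rw [h0] at this
    simpa [abs_of_nonneg hd0, abs_of_nonneg (zero_le_one.trans hΛ)] using this
  have hzd := hdist _ hΛd
  refine ⟨γ (Λ * d), fun y hy => ?_⟩
  have hy' : dist y (γ (Λ * d)) < Λ * d / (2 * β) := hy
  have hhalf : Λ * d / (2 * β) = Λ * d / β / 2 := by field_simp
  have hle : Λ * d / β ≤ Λ * d := div_le_self hΛd.1 hβ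
  have hnn : 0 ≤ Λ * d / β := div_nonneg hΛd.1 hβ0.le
  refine ⟨ball_infDist_frontier_subset hG (hmem _ hΛd) ?_, ?_, ?_⟩
  · rw [mem_ball]
    linarith
  · have := dist_triangle x (γ (Λ * d)) y
    rw [dist_comm] at hy'
    linarith
  · have h1 : infDist (γ (Λ * d)) (frontier G) ≤ infDist y (frontier G) + dist (γ (Λ * d)) y :=
      infDist_le_infDist_add_dist
    rw [dist_comm] at h1
    have h2 : Λ * d / (2 * β) ≤ infDist y (frontier G) := by linarith
    rw [div_le_iff₀ (by positivity)] at h2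
    linarith

theorem Real.abs_rpow_le_two_rpow_mul_add {p : ℝ} (hp : 0 ≤ p) (a b : ℝ) :
    |a| ^ p ≤ 2 ^ p * (|b| ^ p + |a - b| ^ p) := by
  have h1 : |a| ≤ |b| + |a - b| := by
    have := abs_add_le b (a - b)
    simpa using this
  have h2 : |a| ≤ 2 * max |b| |a - b| := by
    linarith [le_max_left |b| |a - b|, le_max_right |b| |a - b|]
  calc |a| ^ p ≤ (2 * max |b| |a - b|) ^ p := Real.rpow_le_rpow (abs_nonneg _) h2 hp
    _ = 2 ^ p * (max |b| |a - b|) ^ p := Real.mul_rpow (by norm_num) (by positivity)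
    _ ≤ _ := by
      gcongr
      have hb : 0 ≤ |b| ^ p := by positivity
      have hc : 0 ≤ |a - b| ^ p := by positivity
      rcases max_cases |b| |a - b| with h | h <;> rw [h.1] <;> linarith

/-- Averaging over the region provided by the John condition, pointwise form. -/
theorem ofReal_abs_rpow_mul_le {n : ℕ} {s p : ℝ} (hp : 0 < p) (hs : 0 < s)
    {G : Set (EuclideanSpace ℝ (Fin n))} (hn : 0 < n) (hG : IsOpen G) {β Λ : ℝ} (hβ : 0 < β)
    (hΛ : 0 < Λ) {x z : EuclideanSpace ℝ (Fin n)} (hx : 0 < infDist x (frontier G))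
    (hz : ball z (Λ * infDist x (frontier G) / (2 * β)) ⊆ whitneyRegion G β Λ x)
    {f : EuclideanSpace ℝ (Fin n) → ℝ} (hf : Measurable f) :
    ENNReal.ofReal (|f x| ^ p * infDist x (frontier G) ^ (-(s * p))) ≤
      ENNReal.ofReal (2 ^ p) * (volume (ball (0 : EuclideanSpace ℝ (Fin n)) 1) *
        ENNReal.ofReal ((1 / (2 * β)) ^ (n : ℝ)))⁻¹ *
        ((∫⁻ y in whitneyRegion G β Λ x,
          ENNReal.ofReal (infDist x (frontier G) ^ (-(s * p)) *
            (Λ * infDist x (frontier G)) ^ (-(n : ℝ))) * ENNReal.ofReal (|f y| ^ p)) +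
          ENNReal.ofReal (2 ^ ((n : ℝ) + s * p) * Λ ^ (s * p)) *
            ∫⁻ y in G, ENNReal.ofReal (|f x - f y| ^ p / ‖x - y‖ ^ ((n : ℝ) + s * p))) := by
  have : Nontrivial (EuclideanSpace ℝ (Fin n)) := by
    have : Nonempty (Fin n) := ⟨⟨0, hn⟩⟩
    infer_instance
  set d := infDist x (frontier G)
  set κ := volume (ball (0 : EuclideanSpace ℝ (Fin n)) 1) *
    ENNReal.ofReal ((1 / (2 * β)) ^ (n : ℝ)) with hκ_def
  have hκ0 : κ ≠ 0 := mul_ne_zero (measure_ball_pos _ _ one_pos).ne'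
    (ENNReal.ofReal_pos.2 (by positivity)).ne'
  have hκt : κ ≠ ⊤ := ENNReal.mul_ne_top measure_ball_lt_top.ne ENNReal.ofReal_ne_top
  set A := whitneyRegion G β Λ x
  have hA : MeasurableSet A := measurableSet_whitneyRegion hG β Λ x
  set I := ∫⁻ y in A, ENNReal.ofReal (|f y| ^ p)
  set g := ∫⁻ y in G, ENNReal.ofReal (|f x - f y| ^ p / ‖x - y‖ ^ ((n : ℝ) + s * p))
  have hvol : κ * ENNReal.ofReal ((Λ * d) ^ (n : ℝ)) ≤ volume A := by
    refine le_trans (le_of_eq ?_) (measure_mono hz)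
    rw [Measure.addHaar_ball _ _ (by positivity), finrank_euclideanSpace_fin, hκ_def, mul_assoc,
      ← ENNReal.ofReal_mul (by positivity), ← Real.mul_rpow (by positivity) (by positivity),
      Real.rpow_natCast, mul_comm]
    congr 3
    ring
  have hint : ENNReal.ofReal (|f x| ^ p) * volume A ≤
      ENNReal.ofReal (2 ^ p) * (I + ENNReal.ofReal ((2 * Λ * d) ^ ((n : ℝ) + s * p)) * g) := by
    rw [← setLIntegral_const]
    calc ∫⁻ _ in A, ENNReal.ofReal (|f x| ^ p)
        ≤ ∫⁻ y in A, ENNReal.ofReal (2 ^ p) * (ENNReal.ofReal (|f y| ^ p) +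
          ENNReal.ofReal ((2 * Λ * d) ^ ((n : ℝ) + s * p)) *
            ENNReal.ofReal (|f x - f y| ^ p / ‖x - y‖ ^ ((n : ℝ) + s * p))) := by
          refine setLIntegral_mono' hA fun y hy => ?_
          rw [← ENNReal.ofReal_mul (by positivity),
            ← ENNReal.ofReal_add (by positivity) (by positivity),
            ← ENNReal.ofReal_mul (by positivity)]
          refine ENNReal.ofReal_le_ofReal ((Real.abs_rpow_le_two_rpow_mul_add hp.le _ (f y)).trans ?_)
          gcongr
          rcases eq_or_ne x y with rfl | hxy
          · simp only [sub_self, abs_zero, Real.zero_rpow hp.ne']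
            positivity
          · have hpos : 0 < ‖x - y‖ := norm_pos_iff.2 (sub_ne_zero.2 hxy)
            rw [mul_div_assoc', le_div_iff₀ (by positivity), mul_comm]
            gcongr
            rw [← dist_eq_norm]
            exact hy.2.1
      _ = ENNReal.ofReal (2 ^ p) * (I + ENNReal.ofReal ((2 * Λ * d) ^ ((n : ℝ) + s * p)) *
            ∫⁻ y in A, ENNReal.ofReal (|f x - f y| ^ p / ‖x - y‖ ^ ((n : ℝ) + s * p))) := by
          rw [lintegral_const_mul' _ _ ENNReal.ofReal_ne_top, lintegral_add_left (by fun_prop),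
            lintegral_const_mul' _ _ ENNReal.ofReal_ne_top]
      _ ≤ _ := by
          gcongr
          exact lintegral_mono_set fun y hy => hy.1
  rw [lintegral_const_mul' _ _ ENNReal.ofReal_ne_top]
  set w := ENNReal.ofReal (d ^ (-(s * p)) * (Λ * d) ^ (-(n : ℝ))) with hw_def
  have hsplit : ENNReal.ofReal (2 ^ ((n : ℝ) + s * p) * Λ ^ (s * p)) =
      w * ENNReal.ofReal ((2 * Λ * d) ^ ((n : ℝ) + s * p)) := by
    rw [hw_def, ← ENNReal.ofReal_mul (by positivity), mul_assoc 2 Λ d,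
      Real.mul_rpow (x := 2) (by norm_num) (by positivity),
      Real.rpow_add (x := Λ * d) (by positivity), Real.rpow_neg (by positivity),
      Real.rpow_neg (by positivity),
      Real.mul_rpow (z := s * p) hΛ.le hx.le]
    congr 1
    field_simp
  have hlhs : ENNReal.ofReal (|f x| ^ p * d ^ (-(s * p))) =
      κ⁻¹ * w * (ENNReal.ofReal (|f x| ^ p) * (κ * ENNReal.ofReal ((Λ * d) ^ (n : ℝ)))) := by
    have h1 : ENNReal.ofReal (d ^ (-(s * p))) = w * ENNReal.ofReal ((Λ * d) ^ (n : ℝ)) := by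
      rw [hw_def, ← ENNReal.ofReal_mul (by positivity), mul_assoc, ← Real.rpow_add (by positivity)]
      simp
    rw [ENNReal.ofReal_mul (by positivity), h1]
    calc _ = (κ⁻¹ * κ) * (ENNReal.ofReal (|f x| ^ p) *
        (w * ENNReal.ofReal ((Λ * d) ^ (n : ℝ)))) := by
          rw [ENNReal.inv_mul_cancel hκ0 hκt, one_mul]
      _ = _ := by ring
  rw [hlhs, hsplit]
  calc _ ≤ κ⁻¹ * w * (ENNReal.ofReal (2 ^ p) *
        (I + ENNReal.ofReal ((2 * Λ * d) ^ ((n : ℝ) + s * p)) * g)) := by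
        exact mul_le_mul_right ((mul_le_mul_right hvol _).trans hint) _
    _ = _ := by ring

theorem infDist_frontier_pos {E : Type*} [PseudoMetricSpace E] {G : Set E} (hG : IsOpen G)
    (hne : (frontier G).Nonempty) {x : E} (hx : x ∈ G) : 0 < infDist x (frontier G) := by
  refine (isClosed_frontier.notMem_iff_infDist_pos hne).1 fun h => ?_
  rw [hG.frontier_eq] at h
  exact h.2 hx

/-- The Aikawa condition controls the mass that reaches a point `y` in the averaging step. -/
theorem lintegral_whitneyRegion_weight_le {n : ℕ} {s p t C₀ : ℝ} (hC₀ : 0 < C₀)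
    (hts : t < (n : ℝ) - s * p) {G : Set (EuclideanSpace ℝ (Fin n))} (hG : IsOpen G)
    (hne : (frontier G).Nonempty)
    (hdim : ∀ x ∈ frontier G, ∀ r : ℝ, 0 < r →
      ∫⁻ y in ball x r, (ENNReal.ofReal (infDist y (frontier G))) ^ (t - (n : ℝ)) ≤
        ENNReal.ofReal (C₀ * r ^ t))
    {β Λ : ℝ} (hβ : 0 < β) (hΛ : 1 ≤ Λ) {y : EuclideanSpace ℝ (Fin n)} (hy : y ∈ G) :
    ∫⁻ x in {x | x ∈ G ∧ y ∈ whitneyRegion G β Λ x},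
      ENNReal.ofReal (infDist x (frontier G) ^ (-(s * p)) *
        (Λ * infDist x (frontier G)) ^ (-(n : ℝ))) ≤
      ENNReal.ofReal ((2 * β) ^ ((n : ℝ) - t - s * p) * 3 ^ (n : ℝ) * C₀ * (4 * β + 2) ^ t *
        Λ ^ (-((n : ℝ) - t - s * p))) *
        ENNReal.ofReal (infDist y (frontier G) ^ (-(s * p))) := by
  have hδ : 0 < infDist y (frontier G) := infDist_frontier_pos hG hne hy
  set δ := infDist y (frontier G) with hδ_def
  set η := (n : ℝ) - t - s * p with hη
  have hη0 : 0 < η := by linarith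
  have hΛ0 : 0 < Λ := by linarith
  obtain ⟨b, hb, hyb⟩ := isClosed_frontier.exists_infDist_eq_dist hne y
  have hS : MeasurableSet {x | x ∈ G ∧ y ∈ whitneyRegion G β Λ x} := by
    rw [ofPred_and]
    exact hG.measurableSet.inter
      ((measurable_prodMk_right (y := y)) (measurableSet_whitneyRegion_uncurry hG β Λ))
  have hsub : {x | x ∈ G ∧ y ∈ whitneyRegion G β Λ x} ⊆ ball b ((4 * β + 2) * δ) := by
    rintro x ⟨-, -, h1, h2⟩
    have := dist_triangle x y b
    rw [mem_ball]
    nlinarith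
  have hpt : ∀ x ∈ {x | x ∈ G ∧ y ∈ whitneyRegion G β Λ x},
      ENNReal.ofReal (infDist x (frontier G) ^ (-(s * p)) *
        (Λ * infDist x (frontier G)) ^ (-(n : ℝ))) ≤
      ENNReal.ofReal ((2 * β * δ / Λ) ^ η * (δ / 3) ^ (-(n : ℝ))) *
        (ENNReal.ofReal (infDist x (frontier G))) ^ (t - (n : ℝ)) := by
    rintro x ⟨hx, -, h1, h2⟩
    have hd : 0 < infDist x (frontier G) := infDist_frontier_pos hG hne hx
    have h3 : infDist y (frontier G) ≤ infDist x (frontier G) + dist y x :=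
      infDist_le_infDist_add_dist
    rw [dist_comm, ← hδ_def] at h3
    set d := infDist x (frontier G)
    rw [ENNReal.ofReal_rpow_of_pos hd, ← ENNReal.ofReal_mul (by positivity)]
    refine ENNReal.ofReal_le_ofReal ?_
    have h4 : d ≤ 2 * β * δ / Λ := by
      rw [le_div_iff₀ hΛ0]
      linarith
    have h5 : δ / 3 ≤ Λ * d := by nlinarith
    have h6 : d ^ (-(s * p)) = d ^ η * d ^ (t - (n : ℝ)) := by
      rw [← Real.rpow_add hd]
      congr 1
      rw [hη]
      ring
    rw [h6, mul_right_comm]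
    gcongr ?_ * ?_ * _
    · exact Real.rpow_le_rpow hd.le h4 hη0.le
    · exact Real.rpow_le_rpow_of_nonpos (by positivity) h5 (by simp)
  calc _ ≤ ∫⁻ x in {x | x ∈ G ∧ y ∈ whitneyRegion G β Λ x},
        ENNReal.ofReal ((2 * β * δ / Λ) ^ η * (δ / 3) ^ (-(n : ℝ))) *
        (ENNReal.ofReal (infDist x (frontier G))) ^ (t - (n : ℝ)) := setLIntegral_mono' hS hpt
    _ ≤ ENNReal.ofReal ((2 * β * δ / Λ) ^ η * (δ / 3) ^ (-(n : ℝ))) *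
        ∫⁻ x in ball b ((4 * β + 2) * δ),
          (ENNReal.ofReal (infDist x (frontier G))) ^ (t - (n : ℝ)) := by
        rw [lintegral_const_mul' _ _ ENNReal.ofReal_ne_top]
        exact mul_le_mul_right (lintegral_mono_set hsub) _
    _ ≤ ENNReal.ofReal ((2 * β * δ / Λ) ^ η * (δ / 3) ^ (-(n : ℝ))) *
        ENNReal.ofReal (C₀ * ((4 * β + 2) * δ) ^ t) :=
        mul_le_mul_right (hdim b hb _ (by positivity)) _
    _ = _ := by
        rw [← ENNReal.ofReal_mul (by positivity), ← ENNReal.ofReal_mul (by positivity)]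
        congr 1
        have h7 : δ ^ (-(s * p)) = δ ^ η * δ ^ (-(n : ℝ)) * δ ^ t := by
          rw [← Real.rpow_add hδ, ← Real.rpow_add hδ]
          congr 1
          rw [hη]
          ring
        rw [h7, Real.div_rpow (by positivity) hΛ0.le, Real.mul_rpow (by positivity) hδ.le,
          Real.div_rpow hδ.le (by norm_num), Real.mul_rpow (by positivity) hδ.le,
          Real.rpow_neg hΛ0.le, Real.rpow_neg (by norm_num : (0 : ℝ) ≤ 3)]
        field_simp

/-- Tonelli for the averaging step, restricted to points at distance at least `ε` from the
frontier. -/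
theorem lintegral_lintegral_whitneyRegion_le {n : ℕ} {G : Set (EuclideanSpace ℝ (Fin n))}
    (hG : IsOpen G) {β Λ : ℝ} (hβ : 0 < β) (hΛ : 2 * β ≤ Λ)
    {w F : EuclideanSpace ℝ (Fin n) → ℝ≥0∞} (hw : Measurable w) (hF : Measurable F) (ε : ℝ) :
    ∫⁻ x in {x | x ∈ G ∧ ε ≤ infDist x (frontier G)}, ∫⁻ y in whitneyRegion G β Λ x, w x * F y ≤
      ∫⁻ y in {x | x ∈ G ∧ ε ≤ infDist x (frontier G)},
        (∫⁻ x in {x | x ∈ G ∧ y ∈ whitneyRegion G β Λ x}, w x) * F y := by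
  set U := {x | x ∈ G ∧ ε ≤ infDist x (frontier G)} with hU_def
  have hU : MeasurableSet U := by
    rw [hU_def, ofPred_and]
    exact hG.measurableSet.inter
      (measurableSet_le measurable_const (continuous_infDist_pt _).measurable)
  set P := {q : EuclideanSpace ℝ (Fin n) × EuclideanSpace ℝ (Fin n) |
    q.1 ∈ U ∧ q.2 ∈ whitneyRegion G β Λ q.1} with hP_def
  have hP : MeasurableSet P := by
    rw [hP_def, ofPred_and]
    exact (measurable_fst hU).inter (measurableSet_whitneyRegion_uncurry hG β Λ)
  set Φ := P.indicator fun q => w q.1 * F q.2 with hΦ_def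
  have hΦ : Measurable Φ := Measurable.indicator (by fun_prop) hP
  calc _ = ∫⁻ x, ∫⁻ y, Φ (x, y) := by
        rw [← lintegral_indicator hU]
        refine lintegral_congr fun x => ?_
        by_cases hx : x ∈ U
        · rw [indicator_of_mem hx, ← lintegral_indicator (measurableSet_whitneyRegion hG β Λ x)]
          refine lintegral_congr fun y => ?_
          by_cases hy : y ∈ whitneyRegion G β Λ x
          · rw [indicator_of_mem hy, hΦ_def, indicator_of_mem (show (x, y) ∈ P from ⟨hx, hy⟩)]
          · rw [indicator_of_notMem hy, hΦ_def,
              indicator_of_notMem (show (x, y) ∉ P from fun h => hy h.2)]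
        · rw [indicator_of_notMem hx]
          refine (lintegral_eq_zero_of_ae_eq_zero (Filter.Eventually.of_forall fun y => ?_)).symm
          rw [hΦ_def, indicator_of_notMem (show (x, y) ∉ P from fun h => hx h.1)]
          rfl
    _ = ∫⁻ y, ∫⁻ x, Φ (x, y) := lintegral_lintegral_swap hΦ.aemeasurable
    _ ≤ _ := by
        rw [← lintegral_indicator hU]
        refine lintegral_mono fun y => ?_
        by_cases hy : y ∈ U
        · have hS : MeasurableSet {x | x ∈ G ∧ y ∈ whitneyRegion G β Λ x} := by
            rw [ofPred_and]
            exact hG.measurableSet.inter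
              ((measurable_prodMk_right (y := y)) (measurableSet_whitneyRegion_uncurry hG β Λ))
          rw [indicator_of_mem hy, ← lintegral_mul_const _ hw, ← lintegral_indicator hS]
          refine lintegral_mono fun x => ?_
          by_cases hx : (x, y) ∈ P
          · rw [hΦ_def, indicator_of_mem hx,
              indicator_of_mem (show x ∈ {x | x ∈ G ∧ y ∈ whitneyRegion G β Λ x} from
                ⟨hx.1.1, hx.2⟩)]
          · rw [hΦ_def, indicator_of_notMem hx]
            exact zero_le
        · rw [indicator_of_notMem hy]
          refine (lintegral_eq_zero_of_ae_eq_zero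
            (Filter.Eventually.of_forall fun x => ?_)).le
          rw [hΦ_def, indicator_of_notMem]
          · rfl
          · rintro ⟨⟨hxG, hxε⟩, hyG, -, h2⟩
            have : (infDist x (frontier G)) ≤ infDist y (frontier G) := by
              have h0 : 0 ≤ infDist x (frontier G) := infDist_nonneg
              nlinarith
            exact hy ⟨hyG, hxε.trans this⟩

theorem ENNReal.le_two_mul_of_le_add_half {a b : ℝ≥0∞} (ha : a ≠ ⊤) (h : a ≤ b + 2⁻¹ * a) :
    a ≤ 2 * b := by
  have h1 : a / 2 ≠ ⊤ := ENNReal.div_ne_top ha (by norm_num)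
  have h2 : a / 2 + a / 2 ≤ b + a / 2 := by
    rw [ENNReal.add_halves, ENNReal.div_eq_inv_mul]
    exact h
  have h3 := (ENNReal.add_le_add_iff_right h1).1 h2
  calc a = a / 2 + a / 2 := (ENNReal.add_halves a).symm
    _ ≤ b + b := add_le_add h3 h3
    _ = 2 * b := (two_mul b).symm

/-- The fractional Hardy inequality on a John domain whose boundary has small Aikawa dimension. -/
theorem IsJohnDomain.fractional_hardy {n : ℕ} (hn : 0 < n) {s p : ℝ} (hp : 0 < p) (hs : 0 < s)
    {G : Set (EuclideanSpace ℝ (Fin n))} {β : ℝ} {x₀ : EuclideanSpace ℝ (Fin n)}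
    (hJohn : IsJohnDomain n G β x₀) (hne : (frontier G).Nonempty)
    (hdim : aikawaDimLT n (frontier G) ((n : ℝ) - s * p)) :
    ∃ C : ℝ≥0∞, C ≠ ⊤ ∧ ∀ f : EuclideanSpace ℝ (Fin n) → ℝ, Measurable f →
      lpInt n p G f ≠ ⊤ →
      ∫⁻ x in G, ENNReal.ofReal (|f x| ^ p * infDist x (frontier G) ^ (-(s * p))) ≤
        C * (lpInt n p G f + gagliardo n s p G f) := by
  obtain ⟨t, C₀, ht, hts, hC₀, hA⟩ := hdim
  have hG : IsOpen G := hJohn.1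
  have hx₀ : x₀ ∈ G := hJohn.2.2.2.1
  have hβ : 0 < β := zero_lt_one.trans_le hJohn.2.2.2.2.1
  have hnt : Nontrivial (EuclideanSpace ℝ (Fin n)) := by
    have : Nonempty (Fin n) := ⟨⟨0, hn⟩⟩
    infer_instance
  have hdm : Measurable fun x : EuclideanSpace ℝ (Fin n) => infDist x (frontier G) :=
    (continuous_infDist_pt _).measurable
  set K₁ := ENNReal.ofReal (2 ^ p) * (volume (ball (0 : EuclideanSpace ℝ (Fin n)) 1) *
        ENNReal.ofReal ((1 / (2 * β)) ^ (n : ℝ)))⁻¹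
  have hK₁ : K₁ ≠ ⊤ := by
    refine ENNReal.mul_ne_top ENNReal.ofReal_ne_top (ENNReal.inv_ne_top.2 ?_)
    exact mul_ne_zero (measure_ball_pos _ _ one_pos).ne'
      (ENNReal.ofReal_pos.2 (by positivity)).ne'
  set η := (n : ℝ) - t - s * p
  have hη : 0 < η := by linarith
  set C' := (2 * β) ^ η * 3 ^ (n : ℝ) * C₀ * (4 * β + 2) ^ t
  obtain ⟨Λ, hΛhalf, hΛ1, hΛβ⟩ : ∃ Λ : ℝ, K₁ * ENNReal.ofReal (C' * Λ ^ (-η)) ≤ 2⁻¹ ∧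
      1 ≤ Λ ∧ 2 * β ≤ Λ := by
    have hlim : Filter.Tendsto (fun Λ : ℝ => K₁.toReal * (C' * Λ ^ (-η))) Filter.atTop
        (nhds 0) := by
      simpa using ((tendsto_rpow_neg_atTop hη).const_mul C').const_mul K₁.toReal
    obtain ⟨Λ, h1, h2, h3⟩ := ((hlim.eventually (gt_mem_nhds (by norm_num : (0 : ℝ) < 2⁻¹))).and
      ((Filter.eventually_ge_atTop 1).and (Filter.eventually_ge_atTop (2 * β)))).exists
    refine ⟨Λ, ?_, h2, h3⟩
    rw [← ENNReal.ofReal_toReal hK₁, ← ENNReal.ofReal_mul ENNReal.toReal_nonneg]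
    refine (ENNReal.ofReal_le_ofReal h1.le).trans (le_of_eq ?_)
    rw [ENNReal.ofReal_inv_of_pos (by norm_num)]
    norm_num
  have hΛ0 : 0 < Λ := by linarith
  set K₂ := ENNReal.ofReal (2 ^ ((n : ℝ) + s * p) * Λ ^ (s * p))
  set c := infDist x₀ (frontier G) / (1 + Λ)
  have hc : 0 < c := div_pos (infDist_frontier_pos hG hne hx₀) (by positivity)
  refine ⟨2 * (ENNReal.ofReal (c ^ (-(s * p))) + K₁ * K₂), ENNReal.mul_ne_top (by norm_num)
    (ENNReal.add_ne_top.2 ⟨ENNReal.ofReal_ne_top,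
      ENNReal.mul_ne_top hK₁ ENNReal.ofReal_ne_top⟩), fun f hf hlp => ?_⟩
  set U : ℝ → Set (EuclideanSpace ℝ (Fin n)) :=
    fun ε => {x | x ∈ G ∧ ε ≤ infDist x (frontier G)} with hU_def
  have hU : ∀ ε, MeasurableSet (U ε) := fun ε => by
    simp only [hU_def, ofPred_and]
    exact hG.measurableSet.inter (measurableSet_le measurable_const hdm)
  have hUG : ∀ ε, U ε ⊆ G := fun ε x hx => hx.1
  set F : EuclideanSpace ℝ (Fin n) → ℝ≥0∞ := fun x => ENNReal.ofReal (|f x| ^ p) with hF_def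
  have hF : Measurable F := by fun_prop
  set W : EuclideanSpace ℝ (Fin n) → ℝ≥0∞ :=
    fun x => ENNReal.ofReal (|f x| ^ p * infDist x (frontier G) ^ (-(s * p))) with hW_def
  set w : EuclideanSpace ℝ (Fin n) → ℝ≥0∞ := fun x =>
    ENNReal.ofReal (infDist x (frontier G) ^ (-(s * p)) *
      (Λ * infDist x (frontier G)) ^ (-(n : ℝ))) with hw_def
  have hw : Measurable w := by fun_prop
  set g : EuclideanSpace ℝ (Fin n) → ℝ≥0∞ := fun x =>
    ∫⁻ y in G, ENNReal.ofReal (|f x - f y| ^ p / ‖x - y‖ ^ ((n : ℝ) + s * p)) with hg_def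
  have hg : Measurable g := by
    refine Measurable.lintegral_prod_right' (f := fun q : EuclideanSpace ℝ (Fin n) ×
      EuclideanSpace ℝ (Fin n) =>
      ENNReal.ofReal (|f q.1 - f q.2| ^ p / ‖q.1 - q.2‖ ^ ((n : ℝ) + s * p))) ?_
    fun_prop
  have hfar : ∀ ε, 0 < ε → ∀ x, ε ≤ infDist x (frontier G) →
      W x ≤ ENNReal.ofReal (ε ^ (-(s * p))) * F x := by
    intro ε hε x hx
    simp only [hW_def, hF_def]
    rw [← ENNReal.ofReal_mul (by positivity), mul_comm (ε ^ _)]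
    refine ENNReal.ofReal_le_ofReal (mul_le_mul_of_nonneg_left ?_ (by positivity))
    exact Real.rpow_le_rpow_of_nonpos hε hx (by nlinarith)
  have hpt : ∀ x ∈ G, W x ≤ ENNReal.ofReal (c ^ (-(s * p))) * F x + (K₁ * K₂ * g x +
      K₁ * ∫⁻ y in whitneyRegion G β Λ x, w x * F y) := by
    intro x hx
    rcases le_or_gt c (infDist x (frontier G)) with h | h
    · exact (hfar c hc x h).trans le_self_add
    · obtain ⟨z, hz⟩ := hJohn.exists_ball_subset_whitneyRegion hΛ1 hx h
      refine (ofReal_abs_rpow_mul_le hp hs hn hG hβ hΛ0 (infDist_frontier_pos hG hne hx) hz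
        hf).trans ?_
      refine le_trans (le_of_eq ?_) le_add_self
      simp only [hw_def, hg_def, hF_def]
      rw [mul_add, add_comm, mul_assoc K₁ K₂]
  have hmain : ∀ ε, 0 < ε → ∫⁻ x in U ε, W x ≤
      2 * (ENNReal.ofReal (c ^ (-(s * p))) + K₁ * K₂) *
        (lpInt n p G f + gagliardo n s p G f) := by
    intro ε hε
    have hfin : ∫⁻ x in U ε, W x ≠ ⊤ := by
      refine ne_top_of_le_ne_top
        (ENNReal.mul_ne_top (ENNReal.ofReal_ne_top (r := ε ^ (-(s * p)))) hlp) ?_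
      calc ∫⁻ x in U ε, W x ≤ ∫⁻ x in U ε, ENNReal.ofReal (ε ^ (-(s * p))) * F x :=
            setLIntegral_mono' (hU ε) fun x hx => hfar ε hε x hx.2
        _ ≤ ∫⁻ x in G, ENNReal.ofReal (ε ^ (-(s * p))) * F x := lintegral_mono_set (hUG ε)
        _ = _ := lintegral_const_mul' _ _ ENNReal.ofReal_ne_top
    have hswap : ∫⁻ x in U ε, ∫⁻ y in whitneyRegion G β Λ x, w x * F y ≤
        ENNReal.ofReal (C' * Λ ^ (-η)) * ∫⁻ x in U ε, W x := by
      refine (lintegral_lintegral_whitneyRegion_le hG hβ hΛβ hw hF ε).trans ?_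
      rw [← lintegral_const_mul' _ _ ENNReal.ofReal_ne_top]
      refine setLIntegral_mono' (hU ε) fun y hy => ?_
      refine (mul_le_mul_left (lintegral_whitneyRegion_weight_le hC₀ hts hG hne hA hβ hΛ1 hy.1)
        _).trans (le_of_eq ?_)
      simp only [hW_def, hF_def]
      rw [mul_assoc, mul_comm (|f y| ^ p),
        ENNReal.ofReal_mul (p := infDist y (frontier G) ^ (-(s * p)))
          (Real.rpow_nonneg infDist_nonneg _)]
    have hstep : ∫⁻ x in U ε, W x ≤ (ENNReal.ofReal (c ^ (-(s * p))) * lpInt n p G f +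
        K₁ * K₂ * gagliardo n s p G f) + 2⁻¹ * ∫⁻ x in U ε, W x := by
      calc ∫⁻ x in U ε, W x
          ≤ ∫⁻ x in U ε, (ENNReal.ofReal (c ^ (-(s * p))) * F x + (K₁ * K₂ * g x +
            K₁ * ∫⁻ y in whitneyRegion G β Λ x, w x * F y)) :=
            setLIntegral_mono' (hU ε) fun x hx => hpt x hx.1
        _ = ENNReal.ofReal (c ^ (-(s * p))) * (∫⁻ x in U ε, F x) + (K₁ * K₂ * (∫⁻ x in U ε, g x) +
            K₁ * ∫⁻ x in U ε, ∫⁻ y in whitneyRegion G β Λ x, w x * F y) := by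
            rw [lintegral_add_left (hF.const_mul _), lintegral_add_left (hg.const_mul _),
              lintegral_const_mul _ hF, lintegral_const_mul _ hg,
              lintegral_const_mul' _ _ hK₁]
        _ ≤ ENNReal.ofReal (c ^ (-(s * p))) * lpInt n p G f +
            (K₁ * K₂ * gagliardo n s p G f + 2⁻¹ * ∫⁻ x in U ε, W x) := by
            refine add_le_add (mul_le_mul_right (lintegral_mono_set (hUG ε)) _)
              (add_le_add (mul_le_mul_right (lintegral_mono_set (hUG ε)) _) ?_)
            calc _ ≤ K₁ * (ENNReal.ofReal (C' * Λ ^ (-η)) * ∫⁻ x in U ε, W x) :=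
                  mul_le_mul_right hswap _
              _ = K₁ * ENNReal.ofReal (C' * Λ ^ (-η)) * ∫⁻ x in U ε, W x := by ring
              _ ≤ _ := mul_le_mul_left hΛhalf _
        _ = _ := by ring
    refine (ENNReal.le_two_mul_of_le_add_half hfin hstep).trans ?_
    rw [mul_assoc 2, add_mul]
    gcongr
    · exact le_self_add
    · exact le_add_self
  have hUnion : G = ⋃ k : ℕ, U (1 / ((k : ℝ) + 1)) := by
    refine Subset.antisymm (fun x hx => ?_) (iUnion_subset fun k => hUG _)
    obtain ⟨k, hk⟩ := exists_nat_one_div_lt (infDist_frontier_pos hG hne hx)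
    exact mem_iUnion.2 ⟨k, hx, hk.le⟩
  rw [hUnion, setLIntegral_iUnion_of_directed, ← hUnion]
  · exact iSup_le fun k => hmain _ (by positivity)
  · refine (monotone_nat_of_le_succ fun k x hx => ⟨hx.1, le_trans ?_ hx.2⟩).directed_le
    exact one_div_le_one_div_of_le (by positivity) (by push_cast; linarith)

/-- Outside of `G` the seminorm of a zero extension is controlled by the Hardy integral. -/
theorem gagliardo_univ_indicator_le {n : ℕ} {s p : ℝ} (hp : 0 < p) (hs : 0 < s)
    {G : Set (EuclideanSpace ℝ (Fin n))} (hG : IsOpen G) (hne : (frontier G).Nonempty) :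
    ∃ C : ℝ≥0∞, C ≠ ⊤ ∧ ∀ f : EuclideanSpace ℝ (Fin n) → ℝ, Measurable f →
      gagliardo n s p univ (G.indicator f) ≤ gagliardo n s p G f + C *
        ∫⁻ x in G, ENNReal.ofReal (|f x| ^ p * infDist x (frontier G) ^ (-(s * p))) := by
  have hsp : 0 < s * p := mul_pos hs hp
  obtain ⟨C, hC, htail⟩ := exists_lintegral_compl_ball_le n (a := (n : ℝ) + s * p) (by linarith)
  refine ⟨2 * C, ENNReal.mul_ne_top (by norm_num) hC, fun f hf => ?_⟩
  have hGm : MeasurableSet G := hG.measurableSet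
  set h := G.indicator f with hh_def
  have hh : Measurable h := hf.indicator hGm
  set Φ : EuclideanSpace ℝ (Fin n) → EuclideanSpace ℝ (Fin n) → ℝ≥0∞ := fun x y =>
    ENNReal.ofReal (|h x - h y| ^ p / ‖x - y‖ ^ ((n : ℝ) + s * p)) with hΦ_def
  have hΦ : Measurable (Function.uncurry Φ) := by
    simp only [hΦ_def, Function.uncurry_def]
    fun_prop
  have hsymm : ∀ x y, Φ x y = Φ y x := fun x y => by
    simp only [hΦ_def]
    rw [abs_sub_comm, norm_sub_rev]
  have hin : ∫⁻ x in G, ∫⁻ y in G, Φ x y = gagliardo n s p G f := by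
    refine setLIntegral_congr_fun hGm fun x hx => setLIntegral_congr_fun hGm fun y hy => ?_
    simp only [hΦ_def, hh_def, indicator_of_mem hx, indicator_of_mem hy]
  have hout : ∫⁻ x in Gᶜ, ∫⁻ y in Gᶜ, Φ x y = 0 := by
    rw [setLIntegral_congr_fun (g := fun _ => 0) hGm.compl, lintegral_zero]
    intro x hx
    simp only
    rw [setLIntegral_congr_fun (g := fun _ => 0) hGm.compl, lintegral_zero]
    intro y hy
    simp only [hΦ_def, hh_def, indicator_of_notMem hx, indicator_of_notMem hy]
    simp [hp.ne']
  have hcross : ∫⁻ x in G, ∫⁻ y in Gᶜ, Φ x y ≤ C *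
      ∫⁻ x in G, ENNReal.ofReal (|f x| ^ p * infDist x (frontier G) ^ (-(s * p))) := by
    rw [← lintegral_const_mul' _ _ hC]
    refine setLIntegral_mono' hGm fun x hx => ?_
    have hd := infDist_frontier_pos hG hne hx
    calc ∫⁻ y in Gᶜ, Φ x y
        = ∫⁻ y in Gᶜ, ENNReal.ofReal (|f x| ^ p) *
          ENNReal.ofReal (1 / ‖x - y‖ ^ ((n : ℝ) + s * p)) := by
          refine setLIntegral_congr_fun hGm.compl fun y hy => ?_
          simp only [hΦ_def, hh_def, indicator_of_mem hx, indicator_of_notMem hy]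
          rw [← ENNReal.ofReal_mul (by positivity), sub_zero, mul_one_div]
      _ = ENNReal.ofReal (|f x| ^ p) *
          ∫⁻ y in Gᶜ, ENNReal.ofReal (1 / ‖x - y‖ ^ ((n : ℝ) + s * p)) :=
          lintegral_const_mul' _ _ ENNReal.ofReal_ne_top
      _ ≤ ENNReal.ofReal (|f x| ^ p) *
          (C * ENNReal.ofReal (infDist x (frontier G) ^ ((n : ℝ) - ((n : ℝ) + s * p)))) :=
          mul_le_mul_right ((lintegral_mono_set
            (compl_subset_compl.2 (ball_infDist_frontier_subset hG hx))).trans (htail x _ hd)) _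
      _ = _ := by
          rw [ENNReal.ofReal_mul (by positivity), sub_add_cancel_left]
          ring
  have hcross' : ∫⁻ x in Gᶜ, ∫⁻ y in G, Φ x y = ∫⁻ x in G, ∫⁻ y in Gᶜ, Φ x y := by
    rw [lintegral_lintegral_swap hΦ.aemeasurable]
    exact lintegral_congr fun x => lintegral_congr fun y => hsymm y x
  have hinner : ∀ A : Set (EuclideanSpace ℝ (Fin n)),
      Measurable fun x => ∫⁻ y in A, Φ x y := fun A => hΦ.lintegral_prod_right'
  have hsplit : ∀ A : Set (EuclideanSpace ℝ (Fin n)), ∫⁻ x in A, ∫⁻ y, Φ x y =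
      (∫⁻ x in A, ∫⁻ y in G, Φ x y) + ∫⁻ x in A, ∫⁻ y in Gᶜ, Φ x y := fun A => by
    rw [← lintegral_add_left (hinner G)]
    exact lintegral_congr fun x => (lintegral_add_compl _ hGm).symm
  calc gagliardo n s p univ h = ∫⁻ x, ∫⁻ y, Φ x y := by
        simp only [gagliardo, Measure.restrict_univ, hΦ_def]
    _ = gagliardo n s p G f + 2 * ∫⁻ x in G, ∫⁻ y in Gᶜ, Φ x y := by
        rw [← lintegral_add_compl _ hGm, hsplit G, hsplit Gᶜ, hin, hout, hcross', add_zero,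
          two_mul, add_assoc]
    _ ≤ _ := by
        rw [mul_assoc]
        exact add_le_add le_rfl (mul_le_mul_right hcross _)

theorem stmt14 (n : ℕ) (hn : 2 ≤ n) (s p : ℝ) (hp : 1 < p)
    (hs0 : 0 < s) (hs1 : s < min 1 ((n : ℝ) / p))
    (G : Set (EuclideanSpace ℝ (Fin n))) (β : ℝ) (x₀ : EuclideanSpace ℝ (Fin n))
    (hJohn : IsJohnDomain n G β x₀)
    (hdim : aikawaDimLT n (frontier G) ((n : ℝ) - s * p)) :
    ∃ C : ℝ, 0 < C ∧
      ∀ f : EuclideanSpace ℝ (Fin n) → ℝ, Measurable f →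
        sobNorm n s p G f < ⊤ →
        sobNorm n s p Set.univ (G.indicator f) ≤
          ENNReal.ofReal C * sobNorm n s p G f := by
  obtain ⟨hG, -, hbdd, hx₀, -, -⟩ := id hJohn
  have hn0 : 0 < n := by omega
  have hp0 : 0 < p := by linarith
  have hne : (frontier G).Nonempty := by
    have : Nonempty (Fin n) := ⟨⟨0, hn0⟩⟩
    refine nonempty_frontier_iff.2 ⟨⟨x₀, hx₀⟩, ?_⟩
    rintro rfl
    exact NormedSpace.unbounded_univ ℝ _ hbdd
  obtain ⟨C₁, hC₁, hHardy⟩ := hJohn.fractional_hardy hn0 hp0 hs0 hne hdim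
  obtain ⟨C₂, hC₂, hExt⟩ := gagliardo_univ_indicator_le (n := n) hp0 hs0 hG hne
  set K := (1 + C₂ * C₁) ^ (1 / p)
  have hK : K ≠ ⊤ := ENNReal.rpow_ne_top_of_nonneg (by positivity)
    (ENNReal.add_ne_top.2 ⟨ENNReal.one_ne_top, ENNReal.mul_ne_top hC₂ hC₁⟩)
  refine ⟨1 + K.toReal, by positivity, fun f hf hfin => ?_⟩
  rw [ENNReal.ofReal_add zero_le_one ENNReal.toReal_nonneg, ENNReal.ofReal_one,
    ENNReal.ofReal_toReal hK]
  have hlp : lpInt n p G f ≠ ⊤ := by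
    intro h
    rw [sobNorm, h, ENNReal.top_rpow_of_pos (by positivity), top_add] at hfin
    exact lt_irrefl _ hfin
  have hlp_univ : lpInt n p univ (G.indicator f) = lpInt n p G f := by
    rw [lpInt, lpInt, Measure.restrict_univ, ← lintegral_indicator hG.measurableSet]
    refine lintegral_congr fun x => ?_
    by_cases hx : x ∈ G
    · simp [hx]
    · simp [hx, hp0.ne']
  have hgag : gagliardo n s p univ (G.indicator f) ≤
      (1 + C₂ * C₁) * (lpInt n p G f + gagliardo n s p G f) := by
    calc _ ≤ gagliardo n s p G f + C₂ * (C₁ * (lpInt n p G f + gagliardo n s p G f)) :=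
          (hExt f hf).trans (add_le_add le_rfl (mul_le_mul_right (hHardy f hf hlp) _))
      _ ≤ (lpInt n p G f + gagliardo n s p G f) +
          C₂ * (C₁ * (lpInt n p G f + gagliardo n s p G f)) := add_le_add le_add_self le_rfl
      _ = _ := by ring
  have hgag' : gagliardo n s p univ (G.indicator f) ^ (1 / p) ≤ K * sobNorm n s p G f := by
    refine (ENNReal.rpow_le_rpow hgag (by positivity)).trans ?_
    rw [ENNReal.mul_rpow_of_nonneg _ _ (by positivity)]
    exact mul_le_mul_right (ENNReal.rpow_add_le_add_rpow _ _ (by positivity)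
      ((div_le_one hp0).2 hp.le)) _
  calc sobNorm n s p univ (G.indicator f)
      ≤ sobNorm n s p G f + K * sobNorm n s p G f := by
        rw [sobNorm, hlp_univ]
        exact add_le_add le_self_add hgag'
    _ = _ := by ring
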